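/- Let N be a weight sequence in the class 𝓛𝓒 which is nonquasianalytic. Then the descendant S^N satisfies condition (S^N,N)_{SV}; in particular, the set of sequences M : ℕ → ℝ_{>0} satisfying (M,N)_{SV} is nonempty. -/

import Mathlib

open Filter

noncomputable def nuq (N : ℕ → ℝ) (p : ℕ) : ℝ := N p / N (p - 1)

def IsLC (N : ℕ → ℝ) : Prop :=
  (∀ p, 0 < N p) ∧ N 0 = 1 ∧ N 0 ≤ N 1 ∧
    (∀ p, 1 ≤ p → (N p) ^ 2 ≤ N (p - 1) * N (p + 1)) ∧
    Tendsto (fun p : ℕ => (N p) ^ ((1 : ℝ) / p)) atTop atTop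

def NQA (N : ℕ → ℝ) : Prop := Summable (fun p : ℕ => 1 / nuq N (p + 1))

noncomputable def tailSum (N : ℕ → ℝ) (p : ℕ) : ℝ := ∑' k : ℕ, 1 / nuq N (p + k)

noncomputable def lamSV (M N : ℕ → ℝ) (s p : ℕ) : ℝ :=
  ⨆ j : Fin p, (M p / ((s : ℝ) ^ p * N j)) ^ ((1 : ℝ) / ((p : ℝ) - (j : ℕ)))

def SVcond (M N : ℕ → ℝ) : Prop :=
  ∃ s : ℕ, 1 ≤ s ∧ ∃ B : ℝ, ∀ p : ℕ, 1 ≤ p → lamSV M N s p / p * tailSum N p ≤ B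

noncomputable def Lseq (N : ℕ → ℝ) (s p : ℕ) : ℝ :=
  if p = 0 then 1
  else (s : ℝ) ^ p * ⨅ j : Fin p, ((p : ℝ) / tailSum N p) ^ (p - (j : ℕ)) * N j

noncomputable def LseqC (N : ℕ → ℝ) (s : ℕ) (C : ℝ) (p : ℕ) : ℝ :=
  if p = 0 then 1
  else (s : ℝ) ^ p * ⨅ j : Fin p, (C * p / tailSum N p) ^ (p - (j : ℕ)) * N j

def Preceq (M N : ℕ → ℝ) : Prop :=
  ∃ B : ℝ, ∀ p : ℕ, 1 ≤ p → (M p / N p) ^ ((1 : ℝ) / p) ≤ B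

def SeqEquiv (M N : ℕ → ℝ) : Prop := Preceq M N ∧ Preceq N M

def Gamma1 (N : ℕ → ℝ) : Prop :=
  ∃ B : ℝ, ∀ p : ℕ, 1 ≤ p → nuq N p / p * tailSum N p ≤ B

def MG (N : ℕ → ℝ) : Prop :=
  ∃ C : ℝ, 1 ≤ C ∧ ∀ j k : ℕ, N (j + k) ≤ C ^ (j + k) * N j * N k

noncomputable def tauD (N : ℕ → ℝ) (p : ℕ) : ℝ := p / nuq N p + tailSum N p

noncomputable def sigmaD (N : ℕ → ℝ) (p : ℕ) : ℝ :=
  if p = 0 then 1 else tauD N 1 * p / tauD N p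

noncomputable def Sdesc (N : ℕ → ℝ) (p : ℕ) : ℝ :=
  ∏ i ∈ Finset.range (p + 1), sigmaD N i

def AlmostIncreasing (a : ℕ → ℝ) : Prop :=
  ∃ C : ℝ, 1 ≤ C ∧ ∀ p q : ℕ, 1 ≤ p → p ≤ q → a p ≤ C * a q

noncomputable def BorelMap (f : ℝ → ℂ) : ℕ → ℂ := fun p => iteratedDeriv p f 0

def DRoumieu (N : ℕ → ℝ) : Set (ℝ → ℂ) :=
  {f | ContDiff ℝ (⊤ : ℕ∞) f ∧ Function.support f ⊆ Set.Icc (-1 : ℝ) 1 ∧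
    ∃ C h : ℝ, 0 < C ∧ 0 < h ∧ ∀ p x, ‖iteratedDeriv p f x‖ ≤ C * h ^ p * N p}

def LambdaRoumieu (M : ℕ → ℝ) : Set (ℕ → ℂ) :=
  {a | ∃ C h : ℝ, 0 < C ∧ 0 < h ∧ ∀ p, ‖a p‖ ≤ C * h ^ p * M p}

def DBeurling (N : ℕ → ℝ) : Set (ℝ → ℂ) :=
  {f | ContDiff ℝ (⊤ : ℕ∞) f ∧ Function.support f ⊆ Set.Icc (-1 : ℝ) 1 ∧
    ∀ h : ℝ, 0 < h → ∃ C : ℝ, 0 < C ∧ ∀ p x, ‖iteratedDeriv p f x‖ ≤ C * h ^ p * N p}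

def LambdaBeurling (M : ℕ → ℝ) : Set (ℕ → ℂ) :=
  {a | ∀ h : ℝ, 0 < h → ∃ C : ℝ, 0 < C ∧ ∀ p, ‖a p‖ ≤ C * h ^ p * M p}

section Descendant

variable {N : ℕ → ℝ}

lemma IsLC.nuq_pos (hN : IsLC N) (p : ℕ) : 0 < nuq N p :=
  div_pos (hN.1 p) (hN.1 (p - 1))

lemma IsLC.nuq_le_succ (hN : IsLC N) {p : ℕ} (hp : 1 ≤ p) : nuq N p ≤ nuq N (p + 1) := by
  have h := hN.2.2.2.1 p hp
  rw [nuq, nuq, Nat.add_sub_cancel, div_le_div_iff₀ (hN.1 _) (hN.1 _)]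
  nlinarith

lemma NQA.summable_tail (hnq : NQA N) {p : ℕ} (hp : 1 ≤ p) :
    Summable fun k : ℕ => 1 / nuq N (p + k) := by
  obtain ⟨q, rfl⟩ := Nat.exists_eq_add_of_le' hp
  refine ((summable_nat_add_iff q).2 hnq).congr fun k => ?_
  rw [show k + q + 1 = q + 1 + k by ring]

lemma NQA.tailSum_eq (hnq : NQA N) {p : ℕ} (hp : 1 ≤ p) :
    tailSum N p = 1 / nuq N p + tailSum N (p + 1) := by
  rw [tailSum, (hnq.summable_tail hp).tsum_eq_zero_add, tailSum]
  simp only [add_zero, add_assoc, add_comm 1]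

lemma IsLC.tailSum_nonneg (hN : IsLC N) (p : ℕ) : 0 ≤ tailSum N p :=
  tsum_nonneg fun k => (one_div_pos.2 (hN.nuq_pos (p + k))).le

lemma IsLC.tauD_pos (hN : IsLC N) {p : ℕ} (hp : 1 ≤ p) : 0 < tauD N p :=
  add_pos_of_pos_of_nonneg (div_pos (by exact_mod_cast hp) (hN.nuq_pos p)) (hN.tailSum_nonneg p)

lemma tauD_succ_le (hN : IsLC N) (hnq : NQA N) {p : ℕ} (hp : 1 ≤ p) :
    tauD N (p + 1) ≤ tauD N p := by
  have h : ((p : ℝ) + 1) / nuq N (p + 1) ≤ (p + 1) / nuq N p :=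
    div_le_div_of_nonneg_left (by positivity) (hN.nuq_pos p) (hN.nuq_le_succ hp)
  rw [tauD, tauD, hnq.tailSum_eq hp, Nat.cast_succ]
  rw [add_div _ _ (nuq N p)] at h
  linarith

lemma IsLC.sigmaD_pos (hN : IsLC N) (p : ℕ) : 0 < sigmaD N p := by
  rw [sigmaD]
  split_ifs with h
  · exact one_pos
  · have hp : 1 ≤ p := Nat.one_le_iff_ne_zero.2 h
    have : (0 : ℝ) < p := by exact_mod_cast hp
    exact div_pos (mul_pos (hN.tauD_pos le_rfl) this) (hN.tauD_pos hp)

lemma sigmaD_mono (hN : IsLC N) (hnq : NQA N) {p q : ℕ} (hp : 1 ≤ p) (hpq : p ≤ q) :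
    sigmaD N p ≤ sigmaD N q := by
  induction q, hpq using Nat.le_induction with
  | base => exact le_rfl
  | succ q hpq ih =>
    have hq : 1 ≤ q := hp.trans hpq
    refine ih.trans ?_
    rw [sigmaD, sigmaD, if_neg (by omega), if_neg (by omega)]
    have h1 := hN.tauD_pos le_rfl
    refine div_le_div₀ (by positivity) ?_ (hN.tauD_pos (by omega)) (tauD_succ_le hN hnq hq)
    push_cast
    nlinarith

lemma IsLC.sigmaD_le (hN : IsLC N) {p : ℕ} (hp : 1 ≤ p) : sigmaD N p ≤ tauD N 1 * nuq N p := by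
  rw [sigmaD, if_neg (by omega), div_le_iff₀ (hN.tauD_pos hp), mul_assoc]
  refine mul_le_mul_of_nonneg_left ?_ (hN.tauD_pos le_rfl).le
  have h := hN.nuq_pos p
  rw [tauD, mul_add, mul_div_cancel₀ _ h.ne']
  linarith [mul_nonneg h.le (hN.tailSum_nonneg p)]

lemma IsLC.sigmaD_div_mul_tailSum_le (hN : IsLC N) {p : ℕ} (hp : 1 ≤ p) :
    sigmaD N p / p * tailSum N p ≤ tauD N 1 := by
  have hp' : (0 : ℝ) < p := by exact_mod_cast hp
  have ht := hN.tauD_pos hp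
  have h : tailSum N p ≤ tauD N p :=
    le_add_of_nonneg_left (div_pos hp' (hN.nuq_pos p)).le
  have e : sigmaD N p / p * tailSum N p = tauD N 1 * (tailSum N p / tauD N p) := by
    rw [sigmaD, if_neg (by omega)]
    field_simp
  rw [e]
  exact mul_le_of_le_one_right (hN.tauD_pos le_rfl).le ((div_le_one ht).2 h)

lemma Sdesc_succ (N : ℕ → ℝ) (p : ℕ) : Sdesc N (p + 1) = Sdesc N p * sigmaD N (p + 1) :=
  Finset.prod_range_succ _ _

lemma IsLC.Sdesc_pos (hN : IsLC N) (p : ℕ) : 0 < Sdesc N p :=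
  Finset.prod_pos fun i _ => hN.sigmaD_pos i

lemma IsLC.Sdesc_le (hN : IsLC N) (p : ℕ) : Sdesc N p ≤ tauD N 1 ^ p * N p := by
  induction p with
  | zero => simp [Sdesc, sigmaD, hN.2.1]
  | succ p ih =>
    have h1 := hN.tauD_pos le_rfl
    have h2 := hN.1 p
    calc Sdesc N (p + 1) = Sdesc N p * sigmaD N (p + 1) := Sdesc_succ N p
      _ ≤ (tauD N 1 ^ p * N p) * (tauD N 1 * nuq N (p + 1)) :=
        mul_le_mul ih (hN.sigmaD_le (by omega)) (hN.sigmaD_pos _).le (by positivity)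
      _ = tauD N 1 ^ (p + 1) * N (p + 1) := by
        rw [nuq, Nat.add_sub_cancel]
        field_simp
        ring

lemma Sdesc_add_le (hN : IsLC N) (hnq : NQA N) (j k : ℕ) :
    Sdesc N (j + k) ≤ Sdesc N j * sigmaD N (j + k) ^ k := by
  induction k with
  | zero => simp
  | succ k ih =>
    rw [← add_assoc, Sdesc_succ, pow_succ, ← mul_assoc]
    refine mul_le_mul_of_nonneg_right (ih.trans ?_) (hN.sigmaD_pos _).le
    refine mul_le_mul_of_nonneg_left ?_ (hN.Sdesc_pos j).le
    rcases k.eq_zero_or_pos with rfl | hk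
    · simp
    · exact pow_le_pow_left₀ (hN.sigmaD_pos _).le (sigmaD_mono hN hnq (by omega) (by omega)) k

lemma lamSV_Sdesc_le (hN : IsLC N) (hnq : NQA N) {s p : ℕ} (hs : 1 ≤ s) (hsτ : tauD N 1 ≤ s) :
    lamSV (Sdesc N) N s p ≤ sigmaD N p := by
  refine Real.iSup_le (fun j => ?_) (hN.sigmaD_pos p).le
  obtain ⟨j, hj⟩ := j
  obtain ⟨k, rfl⟩ := Nat.exists_eq_add_of_lt hj
  have hs' : (1 : ℝ) ≤ s := by exact_mod_cast hs
  have hσ := hN.sigmaD_pos (j + k + 1)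
  have hNj := hN.1 j
  have key : Sdesc N (j + k + 1) / ((s : ℝ) ^ (j + k + 1) * N j)
      ≤ sigmaD N (j + k + 1) ^ (k + 1) := by
    rw [div_le_iff₀ (by positivity)]
    calc Sdesc N (j + k + 1) ≤ Sdesc N j * sigmaD N (j + k + 1) ^ (k + 1) :=
          Sdesc_add_le hN hnq j (k + 1)
      _ ≤ ((s : ℝ) ^ (j + k + 1) * N j) * sigmaD N (j + k + 1) ^ (k + 1) := by
        refine mul_le_mul_of_nonneg_right ((hN.Sdesc_le j).trans ?_) (by positivity)
        refine mul_le_mul_of_nonneg_right ?_ hNj.le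
        exact (pow_le_pow_left₀ (hN.tauD_pos le_rfl).le hsτ j).trans
          (pow_le_pow_right₀ hs' (by omega))
      _ = _ := mul_comm _ _
  have hexp : (1 : ℝ) / (((j + k + 1 : ℕ) : ℝ) - j) = ((k + 1 : ℕ) : ℝ)⁻¹ := by
    push_cast
    rw [one_div]
    congr 1
    ring
  have hS := hN.Sdesc_pos (j + k + 1)
  simp only [hexp]
  calc _ ≤ (sigmaD N (j + k + 1) ^ (k + 1)) ^ (((k + 1 : ℕ) : ℝ)⁻¹) :=
        Real.rpow_le_rpow (by positivity) key (by positivity)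
    _ = sigmaD N (j + k + 1) := Real.pow_rpow_inv_natCast hσ.le (by omega)

lemma SVcond_Sdesc (hN : IsLC N) (hnq : NQA N) : SVcond (Sdesc N) N := by
  refine ⟨max 1 ⌈tauD N 1⌉₊, le_max_left _ _, tauD N 1, fun p hp => ?_⟩
  refine le_trans ?_ (hN.sigmaD_div_mul_tailSum_le hp)
  refine mul_le_mul_of_nonneg_right (div_le_div_of_nonneg_right ?_ p.cast_nonneg)
    (hN.tailSum_nonneg p)
  refine lamSV_Sdesc_le hN hnq (le_max_left _ _) ((Nat.le_ceil _).trans ?_)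
  exact_mod_cast le_max_right _ _

end Descendant

theorem stmt19 (N : ℕ → ℝ) (hN : IsLC N) (hnq : NQA N) :
    SVcond (Sdesc N) N ∧ ∃ M : ℕ → ℝ, (∀ p, 0 < M p) ∧ SVcond M N :=
  ⟨SVcond_Sdesc hN hnq, Sdesc N, hN.Sdesc_pos, SVcond_Sdesc hN hnq⟩
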